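/- arXiv:1812.04253 — 5 statements merged into one kernel-verified Lean document; each statement's English description precedes it below -/
import Mathlib

section
/- (Galerkin structure preservation, integral form.) Let V_h ⊆ V be a closed linear subspace and let u_h : [0,T] → V be continuously differentiable with u_h(t) ∈ V_h for all t ∈ [0,T]. Suppose ⟨C(u_h(t)) ∂_t u_h(t), v_h⟩ = -⟨H'(u_h(t)), v_h⟩ + ⟨f(u_h(t)), v_h⟩ for all v_h ∈ V_h and all t ∈ [0,T]. Then for all 0 ≤ s ≤ t ≤ T: H(u_h(t)) = H(u_h(s)) + ∫_s^t ( ⟨f(u_h(r)), ∂_t u_h(r)⟩ - ⟨C(u_h(r)) ∂_t u_h(r), ∂_t u_h(r)⟩ ) dr. -/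
/-- The derivative, within a set of unique differentiability, of a curve with values in a closed
subspace lies in that subspace. -/
theorem Submodule.mem_of_hasDerivWithinAt_of_isClosed {V : Type*} [NormedAddCommGroup V]
    [NormedSpace ℝ V] {W : Submodule ℝ V} (hW : IsClosed (W : Set V)) {u : ℝ → V} {u' : V}
    {S : Set ℝ} {r : ℝ} (hu : HasDerivWithinAt u u' S r) (hr : r ∈ S)
    (hS : UniqueDiffWithinAt ℝ S r) (hmem : ∀ x ∈ S, u x ∈ W) : u' ∈ W := by
  have : (nhdsWithin r (S \ {r})).NeBot :=
    accPt_principal_iff_nhdsWithin.mp (uniqueDiffWithinAt_iff_accPt.mp hS)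
  refine hW.mem_of_tendsto (hasDerivWithinAt_iff_tendsto_slope.mp hu) ?_
  filter_upwards [self_mem_nhdsWithin] with x hx
  exact W.smul_mem _ (W.sub_mem (hmem x hx.1) (hmem r hr))

/-- Galerkin structure preservation (integral form): a Galerkin approximation
in a closed subspace `V_h` automatically satisfies the integral energy identity. -/
theorem stmt5
    {V : Type*} [NormedAddCommGroup V] [NormedSpace ℝ V]
    (T : ℝ) (hT : 0 ≤ T)
    (H : V → ℝ) (H' : V → (V →L[ℝ] ℝ))
    (hH : ∀ w, HasFDerivAt H (H' w) w) (hH'cont : Continuous H')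
    (C : V → (V →L[ℝ] (V →L[ℝ] ℝ))) (hCcont : Continuous C)
    (f : V → (V →L[ℝ] ℝ)) (hfcont : Continuous f)
    (Vh : Submodule ℝ V) (hVh : IsClosed (Vh : Set V))
    (uh uh' : ℝ → V)
    (hmem : ∀ t ∈ Set.Icc (0 : ℝ) T, uh t ∈ Vh)
    (huh : ∀ t ∈ Set.Icc (0 : ℝ) T, HasDerivAt uh (uh' t) t)
    (huh'cont : ContinuousOn uh' (Set.Icc (0 : ℝ) T))
    (heq : ∀ t ∈ Set.Icc (0 : ℝ) T, ∀ vh ∈ Vh,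
      C (uh t) (uh' t) vh = -(H' (uh t) vh) + f (uh t) vh) :
    ∀ s t : ℝ, 0 ≤ s → s ≤ t → t ≤ T →
      H (uh t) = H (uh s) +
        ∫ r in s..t, (f (uh r) (uh' r) - C (uh r) (uh' r) (uh' r)) := by
  intro s t hs hst ht
  rcases hst.eq_or_lt with rfl | hlt
  · simp
  have hsub : Set.Icc s t ⊆ Set.Icc 0 T := Set.Icc_subset_Icc hs ht
  have henergy : ∀ r ∈ Set.Icc s t,
      f (uh r) (uh' r) - C (uh r) (uh' r) (uh' r) = H' (uh r) (uh' r) := by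
    intro r hr
    have hderiv : uh' r ∈ Vh :=
      Submodule.mem_of_hasDerivWithinAt_of_isClosed hVh (huh r (hsub hr)).hasDerivWithinAt hr
        (uniqueDiffOn_Icc hlt r hr) fun x hx => hmem x (hsub hx)
    linarith [heq r (hsub hr) _ hderiv]
  have huh_cont : ContinuousOn uh (Set.Icc s t) := fun r hr =>
    (huh r (hsub hr)).continuousAt.continuousWithinAt
  have hcont : ContinuousOn (fun r => H' (uh r) (uh' r)) (Set.Icc s t) :=
    (hH'cont.comp_continuousOn huh_cont).clm_apply (huh'cont.mono hsub)
  rw [← Set.uIcc_of_le hst] at henergy hcont hsub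
  rw [intervalIntegral.integral_congr henergy,
    intervalIntegral.integral_eq_sub_of_hasDerivAt
      (fun r hr => (hH (uh r)).comp_hasDerivAt r (huh r (hsub hr))) hcont.intervalIntegrable]
  simp
end

section
/- (Petrov-Galerkin time step, single interval.) Fix k ∈ ℕ and s < t in ℝ. Let a_0, …, a_{k+1} ∈ V and define the polynomial curve u(r) = Σ_{i=0}^{k+1} r^i · a_i, with derivative u'(r) = Σ_{i=1}^{k+1} i r^{i-1} · a_i. Suppose that for every choice of b_0, …, b_k ∈ V, writing w(r) = Σ_{i=0}^{k} r^i · b_i, one has ∫_s^t ⟨C(u(r)) u'(r), w(r)⟩ dr = ∫_s^t ( ⟨f(u(r)), w(r)⟩ - ⟨H'(u(r)), w(r)⟩ ) dr. Then the discrete energy identity holds: H(u(t)) = H(u(s)) + ∫_s^t ( ⟨f(u(r)), u'(r)⟩ - ⟨C(u(r)) u'(r), u'(r)⟩ ) dr. -/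
/-- Petrov-Galerkin time step on a single interval: if the polynomial ansatz
`u` of degree `k+1` satisfies the variational identity against all `V`-valued
polynomial test functions of degree `k`, then the discrete energy identity holds. -/
theorem stmt6
    {V : Type*} [NormedAddCommGroup V] [NormedSpace ℝ V]
    (H : V → ℝ) (H' : V → (V →L[ℝ] ℝ))
    (hH : ∀ w, HasFDerivAt H (H' w) w) (hH'cont : Continuous H')
    (C : V → (V →L[ℝ] (V →L[ℝ] ℝ))) (hCcont : Continuous C)
    (f : V → (V →L[ℝ] ℝ)) (hfcont : Continuous f)
    (k : ℕ) (s t : ℝ) (hst : s < t)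
    (a : Fin (k + 2) → V) (u u' : ℝ → V)
    (hu : u = fun r => ∑ i : Fin (k + 2), r ^ (i : ℕ) • a i)
    (hu' : u' = fun r => ∑ i : Fin (k + 2), (((i : ℕ) : ℝ) * r ^ ((i : ℕ) - 1)) • a i)
    (hvar : ∀ b : Fin (k + 1) → V,
      (∫ r in s..t, C (u r) (u' r) (∑ i : Fin (k + 1), r ^ (i : ℕ) • b i)) =
        ∫ r in s..t, (f (u r) (∑ i : Fin (k + 1), r ^ (i : ℕ) • b i) -
          H' (u r) (∑ i : Fin (k + 1), r ^ (i : ℕ) • b i))) :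
    H (u t) = H (u s) +
      ∫ r in s..t, (f (u r) (u' r) - C (u r) (u' r) (u' r)) := by
  have hu_deriv : ∀ r, HasDerivAt u (u' r) r := by
    intro r
    rw [hu, hu']
    exact HasDerivAt.fun_sum fun i _ => (hasDerivAt_pow (i : ℕ) r).smul_const (a i)
  have hu_cont : Continuous u := continuous_iff_continuousAt.2 fun r => (hu_deriv r).continuousAt
  have hu'_cont : Continuous u' := by
    rw [hu']
    fun_prop
  have hu'_test : ∀ r, ∑ i : Fin (k + 1), r ^ (i : ℕ) • (((i : ℕ) : ℝ) + 1) • a i.succ = u' r := by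
    intro r
    simp only [hu']
    rw [Fin.sum_univ_succ (n := k + 1)]
    simp [smul_smul, mul_comm]
  have hf_int : IntervalIntegrable (fun r => f (u r) (u' r)) MeasureTheory.volume s t :=
    ((hfcont.comp hu_cont).clm_apply hu'_cont).intervalIntegrable s t
  have hH_int : IntervalIntegrable (fun r => H' (u r) (u' r)) MeasureTheory.volume s t :=
    ((hH'cont.comp hu_cont).clm_apply hu'_cont).intervalIntegrable s t
  have hC_int : IntervalIntegrable (fun r => C (u r) (u' r) (u' r)) MeasureTheory.volume s t :=
    (((hCcont.comp hu_cont).clm_apply hu'_cont).clm_apply hu'_cont).intervalIntegrable s t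
  have hftc : ∫ r in s..t, H' (u r) (u' r) = H (u t) - H (u s) :=
    intervalIntegral.integral_eq_sub_of_hasDerivAt
      (fun r _ => (hH (u r)).comp_hasDerivAt r (hu_deriv r)) hH_int
  have hbalance := hvar fun i => (((i : ℕ) : ℝ) + 1) • a i.succ
  simp only [hu'_test] at hbalance
  rw [intervalIntegral.integral_sub hf_int hH_int] at hbalance
  rw [intervalIntegral.integral_sub hf_int hC_int]
  linarith
end

section
/- (Petrov-Galerkin time discretization on a grid.) Fix k ∈ ℕ, N ∈ ℕ, and grid points t^0 < t^1 < … < t^N. Let u : [t^0, t^N] → V be continuous, and suppose that on each subinterval [t^{n-1}, t^n] (1 ≤ n ≤ N) the function u agrees with a V-valued polynomial of degree ≤ k+1 (so u is differentiable in the interior of each subinterval with derivative u'), and that for every choice of b_0, …, b_k ∈ V, writing w(r) = Σ_{i=0}^{k} r^i · b_i, one has ∫_{t^{n-1}}^{t^n} ⟨C(u(r)) u'(r), w(r)⟩ dr = ∫_{t^{n-1}}^{t^n} ( ⟨f(u(r)), w(r)⟩ - ⟨H'(u(r)), w(r)⟩ ) dr. Then for all indices 0 ≤ m ≤ n ≤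 N: H(u(t^n)) = H(u(t^m)) + ∫_{t^m}^{t^n} ( ⟨f(u(r)), u'(r)⟩ - ⟨C(u(r)) u'(r), u'(r)⟩ ) dr. -/
open MeasureTheory Set in
/-- Energy identity on one interval: if `u` agrees on `[a, b]` with a `C¹` curve `p` whose
derivative is `q`, `u'` agrees with `q` on `(a, b)`, and the variational identity holds when
tested with `q`, then the dissipation rate is integrable and integrates to the change of `H`. -/
theorem energy_identity_of_variational_identity
    {V : Type*} [NormedAddCommGroup V] [NormedSpace ℝ V]
    {H : V → ℝ} {H' : V → (V →L[ℝ] ℝ)}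
    (hH : ∀ w, HasFDerivAt H (H' w) w) (hH' : Continuous H')
    {C : V → (V →L[ℝ] (V →L[ℝ] ℝ))} (hC : Continuous C)
    {f : V → (V →L[ℝ] ℝ)} (hf : Continuous f)
    {a b : ℝ} (hab : a ≤ b) {u u' p q : ℝ → V}
    (hpq : ∀ r, HasDerivAt p (q r) r) (hq : Continuous q)
    (hu : EqOn u p (Icc a b)) (hu' : EqOn u' q (Ioo a b))
    (hvar : ∫ r in a..b, C (u r) (u' r) (q r) =
      ∫ r in a..b, (f (u r) (q r) - H' (u r) (q r))) :
    IntervalIntegrable (fun r => f (u r) (u' r) - C (u r) (u' r) (u' r)) volume a b ∧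
      H (u b) = H (u a) + ∫ r in a..b, (f (u r) (u' r) - C (u r) (u' r) (u' r)) := by
  have hp : Continuous p := continuous_iff_continuousAt.2 fun r => (hpq r).continuousAt
  have hfq : Continuous fun r => f (p r) (q r) := (hf.comp hp).clm_apply hq
  have hHq : Continuous fun r => H' (p r) (q r) := (hH'.comp hp).clm_apply hq
  have hCq : Continuous fun r => C (p r) (q r) (q r) :=
    ((hC.comp hp).clm_apply hq).clm_apply hq
  have hup : EqOn u p (Ioo a b) := hu.mono Ioo_subset_Icc_self
  have hrate : EqOn (fun r => f (p r) (q r) - C (p r) (q r) (q r))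
      (fun r => f (u r) (u' r) - C (u r) (u' r) (u' r)) (Ioo a b) := fun r hr => by
    simp only [hup hr, hu' hr]
  have hvar' : ∫ r in a..b, C (p r) (q r) (q r) =
      ∫ r in a..b, (f (p r) (q r) - H' (p r) (q r)) := by
    refine Eq.trans ?_ (hvar.trans ?_)
    · exact intervalIntegral.integral_congr_Ioo_of_le hab fun r hr => by
        simp only [hup hr, hu' hr]
    · exact intervalIntegral.integral_congr_Ioo_of_le hab fun r hr => by
        simp only [hup hr]
  have hFTC : ∫ r in a..b, H' (p r) (q r) = H (p b) - H (p a) :=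
    intervalIntegral.integral_eq_sub_of_hasDerivAt
      (fun r _ => (hH (p r)).comp_hasDerivAt r (hpq r)) (hHq.intervalIntegrable a b)
  refine ⟨((hfq.sub hCq).intervalIntegrable a b).congr_uIoo (by rwa [uIoo_of_le hab]), ?_⟩
  rw [← intervalIntegral.integral_congr_Ioo_of_le hab hrate, hu (left_mem_Icc.2 hab),
    hu (right_mem_Icc.2 hab),
    intervalIntegral.integral_sub (hfq.intervalIntegrable a b) (hCq.intervalIntegrable a b),
    hvar', intervalIntegral.integral_sub (hfq.intervalIntegrable a b)
      (hHq.intervalIntegrable a b), hFTC]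
  ring

/-- Petrov-Galerkin time discretization on a grid: the continuous piecewise
polynomial approximation of degree `k+1` satisfying the variational identity on
each subinterval obeys the discrete energy identity between any two grid points. -/
theorem stmt7
    {V : Type*} [NormedAddCommGroup V] [NormedSpace ℝ V]
    (H : V → ℝ) (H' : V → (V →L[ℝ] ℝ))
    (hH : ∀ w, HasFDerivAt H (H' w) w) (hH'cont : Continuous H')
    (C : V → (V →L[ℝ] (V →L[ℝ] ℝ))) (hCcont : Continuous C)
    (f : V → (V →L[ℝ] ℝ)) (hfcont : Continuous f)
    (k N : ℕ) (tg : ℕ → ℝ) (htg : ∀ n < N, tg n < tg (n + 1))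
    (u u' : ℝ → V)
    (hucont : ContinuousOn u (Set.Icc (tg 0) (tg N)))
    (hpoly : ∀ n, 1 ≤ n → n ≤ N → ∃ a : Fin (k + 2) → V,
      (∀ r ∈ Set.Icc (tg (n - 1)) (tg n),
        u r = ∑ i : Fin (k + 2), r ^ (i : ℕ) • a i) ∧
      (∀ r ∈ Set.Ioo (tg (n - 1)) (tg n),
        u' r = ∑ i : Fin (k + 2), (((i : ℕ) : ℝ) * r ^ ((i : ℕ) - 1)) • a i))
    (hvar : ∀ n, 1 ≤ n → n ≤ N → ∀ b : Fin (k + 1) → V,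
      (∫ r in tg (n - 1)..tg n,
          C (u r) (u' r) (∑ i : Fin (k + 1), r ^ (i : ℕ) • b i)) =
        ∫ r in tg (n - 1)..tg n,
          (f (u r) (∑ i : Fin (k + 1), r ^ (i : ℕ) • b i) -
            H' (u r) (∑ i : Fin (k + 1), r ^ (i : ℕ) • b i))) :
    ∀ m n : ℕ, m ≤ n → n ≤ N →
      H (u (tg n)) = H (u (tg m)) +
        ∫ r in tg m..tg n, (f (u r) (u' r) - C (u r) (u' r) (u' r)) := by
  have hstep : ∀ n < N,
      IntervalIntegrable (fun r => f (u r) (u' r) - C (u r) (u' r) (u' r))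
        MeasureTheory.volume (tg n) (tg (n + 1)) ∧
      H (u (tg (n + 1))) = H (u (tg n)) +
        ∫ r in tg n..tg (n + 1), (f (u r) (u' r) - C (u r) (u' r) (u' r)) := by
    intro n hn
    obtain ⟨a, hu, hu'⟩ := hpoly (n + 1) (by omega) hn
    have hv := hvar (n + 1) (by omega) hn fun i => ((i : ℝ) + 1) • a i.succ
    have hq : ∀ r : ℝ, ∑ i : Fin (k + 1), r ^ (i : ℕ) • ((i : ℝ) + 1) • a i.succ =
        ∑ i : Fin (k + 2), (((i : ℕ) : ℝ) * r ^ ((i : ℕ) - 1)) • a i := fun r => by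
      rw [Fin.sum_univ_succ (n := k + 1)]
      simp [smul_smul, mul_comm]
    simp only [hq, Nat.add_sub_cancel] at hv hu hu'
    exact energy_identity_of_variational_identity hH hH'cont hCcont hfcont (htg n hn).le
      (fun r => HasDerivAt.fun_sum fun (i : Fin (k + 2)) _ =>
        (hasDerivAt_pow (i : ℕ) r).smul_const (a i))
      (by fun_prop) hu hu' hv
  intro m n hmn hnN
  have hint : ∀ j, m ≤ j → j ≤ N →
      IntervalIntegrable (fun r => f (u r) (u' r) - C (u r) (u' r) (u' r))
        MeasureTheory.volume (tg m) (tg j) := fun j hmj hjN =>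
    IntervalIntegrable.trans_iterate_Ico hmj fun i hi => (hstep i (hi.2.trans_le hjN)).1
  induction n, hmn using Nat.le_induction with
  | base => simp
  | succ n hmn ih =>
    rw [(hstep n hnN).2, ih (by omega), add_assoc,
      intervalIntegral.integral_add_adjacent_intervals (hint n hmn (by omega)) (hstep n hnN).1]
end

section
/- (Energy conservation of the average vector field step for Hamiltonian systems.) Suppose C(w) is skew for every w ∈ V, i.e. ⟨C(w)v₁, v₂⟩ = -⟨C(w)v₂, v₁⟩ for all v₁, v₂ ∈ V. Let τ > 0 and u⁰, u¹ ∈ V satisfy the average vector field scheme (∫_0^1 C(u⁰ + s(u¹-u⁰)) ds)((u¹ - u⁰)/τ) = -∫_0^1 H'(u⁰ + s(u¹-u⁰)) ds in V', where the integrals are Bochner integrals in L(V,V') and V' respectively. Then H(u¹) = H(u⁰). -/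
open MeasureTheory


/-- Energy conservation of the average vector field step for Hamiltonian
systems: if `C(w)` is skew for every `w` and `(u⁰, u¹)` satisfies the average
vector field scheme, then `H(u¹) = H(u⁰)`. -/
theorem stmt9
    {V : Type*} [NormedAddCommGroup V] [NormedSpace ℝ V]
    (H : V → ℝ) (H' : V → (V →L[ℝ] ℝ))
    (hH : ∀ w, HasFDerivAt H (H' w) w) (hH'cont : Continuous H')
    (C : V → (V →L[ℝ] (V →L[ℝ] ℝ))) (hCcont : Continuous C)
    (hskew : ∀ w v₁ v₂ : V, C w v₁ v₂ = -(C w v₂ v₁))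
    (τ : ℝ) (hτ : 0 < τ) (u0 u1 : V)
    (havf : (∫ s in (0 : ℝ)..1, C (u0 + s • (u1 - u0))) (τ⁻¹ • (u1 - u0)) =
      -(∫ s in (0 : ℝ)..1, H' (u0 + s • (u1 - u0)))) :
    H u1 = H u0 := by
  have hγ : Continuous fun s : ℝ => u0 + s • (u1 - u0) := by fun_prop
  set_option maxSynthPendingDepth 3 in
  have hCint : IntervalIntegrable (fun s : ℝ => C (u0 + s • (u1 - u0))) volume 0 1 :=
    (hCcont.comp hγ).intervalIntegrable 0 1
  have hCapp : IntervalIntegrable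
      (fun s : ℝ => C (u0 + s • (u1 - u0)) (τ⁻¹ • (u1 - u0))) volume 0 1 :=
    ((hCcont.comp hγ).clm_apply continuous_const).intervalIntegrable 0 1
  have hHint : IntervalIntegrable (fun s : ℝ => H' (u0 + s • (u1 - u0))) volume 0 1 :=
    (hH'cont.comp hγ).intervalIntegrable 0 1
  have hCdiag : ∀ w v : V, C w v v = 0 := fun w v => by linarith [hskew w v v]
  have hpaired := congrArg (fun φ : V →L[ℝ] ℝ => φ (u1 - u0)) havf
  simp only [neg_apply] at hpaired
  rw [ContinuousLinearMap.intervalIntegral_apply hCint,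
    ContinuousLinearMap.intervalIntegral_apply hCapp,
    ContinuousLinearMap.intervalIntegral_apply hHint] at hpaired
  have hFTC : ∫ s in (0 : ℝ)..1, H' (u0 + s • (u1 - u0)) (u1 - u0) = H u1 - H u0 := by
    have hderiv : ∀ s ∈ Set.uIcc (0 : ℝ) 1, HasDerivAt (fun s : ℝ => H (u0 + s • (u1 - u0)))
        (H' (u0 + s • (u1 - u0)) (u1 - u0)) s := fun s _ => by
      have hγ' : HasDerivAt (fun s : ℝ => u0 + s • (u1 - u0)) (u1 - u0) s := by
        simpa using ((hasDerivAt_id s).smul_const (u1 - u0)).const_add u0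
      exact (hH _).comp_hasDerivAt s hγ'
    rw [intervalIntegral.integral_eq_sub_of_hasDerivAt hderiv
      (((hH'cont.comp hγ).clm_apply continuous_const).intervalIntegrable 0 1)]
    simp
  rw [hFTC] at hpaired
  simp only [map_smul, smul_apply, hCdiag, smul_zero,
    intervalIntegral.integral_zero] at hpaired
  linarith
end

section
/- (Energy conservation of the Petrov-Galerkin time discretization for Hamiltonian systems.) Suppose C(w) is skew for every w ∈ V, i.e. ⟨C(w)v₁, v₂⟩ = -⟨C(w)v₂, v₁⟩ for all v₁, v₂ ∈ V, and f ≡ 0. Fix k ∈ ℕ, N ∈ ℕ, and grid points t^0 < t^1 < … < t^N. Let u : [t^0, t^N] → V be continuous, agreeing on each subinterval [t^{n-1}, t^n] with a V-valued polynomial of degree ≤ k+1 (with derivative u' in the interior of each subinterval), and suppose that for every choice of b_0, …, b_k ∈ V, writing w(r) = Σ_{i=0}^{k} r^i · b_i, one has ∫_{t^{n-1}}^{t^n} ⟨C(u(r)) u'(r), w(r)⟩ dr = -∫_{t^{n-1}}^{t^n} ⟨H'(u(r)), w(r)⟩ dr for each 1 ≤ n ≤ N. Then H(u(t^n)) = H(u(t^0))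 for all 0 ≤ n ≤ N. -/
theorem hasDerivAt_sum_pow_smul {V : Type*} [NormedAddCommGroup V] [NormedSpace ℝ V]
    {m : ℕ} (a : Fin m → V) (r : ℝ) :
    HasDerivAt (fun r : ℝ => ∑ i : Fin m, r ^ (i : ℕ) • a i)
      (∑ i : Fin m, (((i : ℕ) : ℝ) * r ^ ((i : ℕ) - 1)) • a i) r :=
  HasDerivAt.fun_sum fun i _ => (hasDerivAt_pow (i : ℕ) r).smul_const (a i)

/-- The derivative of a vector-valued polynomial, as a polynomial of one degree less. -/
theorem sum_pow_smul_succ {V : Type*} [AddCommGroup V] [Module ℝ V]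
    {m : ℕ} (a : Fin (m + 1) → V) (r : ℝ) :
    ∑ i : Fin m, r ^ (i : ℕ) • (((i : ℕ) : ℝ) + 1) • a i.succ =
      ∑ i : Fin (m + 1), (((i : ℕ) : ℝ) * r ^ ((i : ℕ) - 1)) • a i := by
  simp [Fin.sum_univ_succ, smul_smul, mul_comm]

/-- The fundamental theorem of calculus along a vector-valued polynomial. -/
theorem integral_fderiv_comp_polynomial {V : Type*} [NormedAddCommGroup V] [NormedSpace ℝ V]
    {H : V → ℝ} {H' : V → (V →L[ℝ] ℝ)} (hH : ∀ w, HasFDerivAt H (H' w) w)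
    (hH'cont : Continuous H') {m : ℕ} (a : Fin m → V) (s t : ℝ) :
    ∫ r in s..t, H' (∑ i : Fin m, r ^ (i : ℕ) • a i)
        (∑ i : Fin m, (((i : ℕ) : ℝ) * r ^ ((i : ℕ) - 1)) • a i) =
      H (∑ i : Fin m, t ^ (i : ℕ) • a i) - H (∑ i : Fin m, s ^ (i : ℕ) • a i) := by
  refine intervalIntegral.integral_eq_sub_of_hasDerivAt
    (f := fun r : ℝ => H (∑ i : Fin m, r ^ (i : ℕ) • a i))
    (fun r _ => (hH _).comp_hasDerivAt r (hasDerivAt_sum_pow_smul a r)) ?_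
  refine Continuous.intervalIntegrable ?_ _ _
  exact (hH'cont.comp (by fun_prop)).clm_apply (by fun_prop)


/-- Energy conservation of the Petrov-Galerkin time discretization for
Hamiltonian systems: if `C(w)` is skew for every `w` and `f ≡ 0`, the energy is
conserved at all grid points. -/
theorem stmt10
    {V : Type*} [NormedAddCommGroup V] [NormedSpace ℝ V]
    (H : V → ℝ) (H' : V → (V →L[ℝ] ℝ))
    (hH : ∀ w, HasFDerivAt H (H' w) w) (hH'cont : Continuous H')
    (C : V → (V →L[ℝ] (V →L[ℝ] ℝ))) (hCcont : Continuous C)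
    (hskew : ∀ w v₁ v₂ : V, C w v₁ v₂ = -(C w v₂ v₁))
    (k N : ℕ) (tg : ℕ → ℝ) (htg : ∀ n < N, tg n < tg (n + 1))
    (u u' : ℝ → V)
    (hucont : ContinuousOn u (Set.Icc (tg 0) (tg N)))
    (hpoly : ∀ n, 1 ≤ n → n ≤ N → ∃ a : Fin (k + 2) → V,
      (∀ r ∈ Set.Icc (tg (n - 1)) (tg n),
        u r = ∑ i : Fin (k + 2), r ^ (i : ℕ) • a i) ∧
      (∀ r ∈ Set.Ioo (tg (n - 1)) (tg n),
        u' r = ∑ i : Fin (k + 2), (((i : ℕ) : ℝ) * r ^ ((i : ℕ) - 1)) • a i))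
    (hvar : ∀ n, 1 ≤ n → n ≤ N → ∀ b : Fin (k + 1) → V,
      (∫ r in tg (n - 1)..tg n,
          C (u r) (u' r) (∑ i : Fin (k + 1), r ^ (i : ℕ) • b i)) =
        -∫ r in tg (n - 1)..tg n,
          H' (u r) (∑ i : Fin (k + 1), r ^ (i : ℕ) • b i)) :
    ∀ n : ℕ, n ≤ N → H (u (tg n)) = H (u (tg 0)) := by
  intro n hn
  induction n with
  | zero => rfl
  | succ n ih =>
    rw [← ih (by omega)]
    have hle : tg n ≤ tg (n + 1) := (htg n (by omega)).le
    obtain ⟨a, hu, hu'⟩ := hpoly (n + 1) (by omega) hn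
    have hv := hvar (n + 1) (by omega) hn fun i => (((i : ℕ) : ℝ) + 1) • a i.succ
    simp only [Nat.add_sub_cancel] at hu hu' hv
    have hsum := sum_pow_smul_succ a
    simp only [hsum] at hv
    have hleft : (∫ r in tg n..tg (n + 1), C (u r) (u' r)
        (∑ i : Fin (k + 2), (((i : ℕ) : ℝ) * r ^ ((i : ℕ) - 1)) • a i)) = 0 := by
      rw [intervalIntegral.integral_of_le hle, MeasureTheory.integral_Ioc_eq_integral_Ioo]
      refine MeasureTheory.setIntegral_eq_zero_of_forall_eq_zero fun r hr => ?_
      rw [← hu' r hr]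
      linarith [hskew (u r) (u' r) (u' r)]
    have hftc := integral_fderiv_comp_polynomial hH hH'cont a (tg n) (tg (n + 1))
    have hright : (∫ r in tg n..tg (n + 1), H' (u r)
        (∑ i : Fin (k + 2), (((i : ℕ) : ℝ) * r ^ ((i : ℕ) - 1)) • a i)) =
        H (u (tg (n + 1))) - H (u (tg n)) := by
      rw [hu _ (Set.left_mem_Icc.2 hle), hu _ (Set.right_mem_Icc.2 hle), ← hftc]
      refine intervalIntegral.integral_congr fun r hr => ?_
      rw [Set.uIcc_of_le hle] at hr
      simp only [hu r hr]
    linarith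
end
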